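/- arXiv:2601.18243 — 2 statements merged into one kernel-verified Lean document; each statement's English description precedes it below -/
import Mathlib

section
/- Let k be a field. For t = 1,…,n let Rₜ be a square matrix over k with rows and columns indexed by pairs from {1,…,mₜ}, let Pₜ be the flip matrix on {1,…,mₜ}, and suppose there is a finite set Iₜ ⊆ k such that ∏_{λ ∈ Iₜ} (Pₜ Rₜ − λ·Id) = 0. Let R_⊗ be the tensor R-matrix of R₁,…,Rₙ and let P be the flip matrix on the index set {1,…,m₁} × ⋯ × {1,…,mₙ}. Then ∏_{(λ₁,…,λₙ) ∈ I₁ × ⋯ × Iₙ} (P·R_⊗ − λ₁λ₂⋯λₙ·Id) = 0. Moreover, if each matrix Pₜ Rₜ is diagonalizable over k, then P·R_⊗ is diagonalizable over k. -/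
/-!
STATEMENT 4: if each braiding `Pₜ Rₜ` satisfies `∏_{λ ∈ Iₜ} (Pₜ Rₜ − λ·Id) = 0`
(an identity between pairwise-commuting factors, expressed as the evaluation of the
polynomial `∏_{λ ∈ Iₜ} (X − λ)` at `Pₜ Rₜ`), then the braiding `P·R_⊗` of the tensor
R-matrix satisfies `∏_{(λ₁,…,λₙ) ∈ I₁ × ⋯ × Iₙ} (P·R_⊗ − λ₁⋯λₙ·Id) = 0`.
Moreover diagonalizability of each `Pₜ Rₜ` implies diagonalizability of `P·R_⊗`.
-/

open Matrix Polynomial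

/-- The flip matrix `P` on an index set `S`: `P^{ij}_{kl} = δ_{il} δ_{jk}`. -/
def flipMatrix (k S : Type*) [Semiring k] [DecidableEq S] :
    Matrix (S × S) (S × S) k :=
  fun p q => if p.1 = q.2 ∧ p.2 = q.1 then 1 else 0

/-- The tensor R-matrix of a family `R₁,…,Rₙ`, with entries
`(R_⊗)^{(i₁…iₙ)(j₁…jₙ)}_{(k₁…kₙ)(l₁…lₙ)} = ∏ₜ (Rₜ)^{iₜjₜ}_{kₜlₜ}`. -/
def tensorRFamily {k : Type*} [CommRing k] {n : ℕ} {m : Fin n → ℕ}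
    (R : ∀ t, Matrix (Fin (m t) × Fin (m t)) (Fin (m t) × Fin (m t)) k) :
    Matrix (((t : Fin n) → Fin (m t)) × ((t : Fin n) → Fin (m t)))
           (((t : Fin n) → Fin (m t)) × ((t : Fin n) → Fin (m t))) k :=
  fun p q => ∏ t, R t (p.1 t, p.2 t) (q.1 t, q.2 t)

/-- A square matrix is diagonalizable over `k` if it is conjugate to a diagonal matrix. -/
def IsDiagonalizable {k : Type*} [Field k] {ι : Type*} [Fintype ι] [DecidableEq ι]
    (M : Matrix ι ι k) : Prop :=
  ∃ Q : Matrix ι ι k, IsUnit Q.det ∧ (Q⁻¹ * M * Q).IsDiag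

section TensorRFamily

variable {k : Type*} {n : ℕ} {m : Fin n → ℕ}

theorem tensorRFamily_mul [CommRing k]
    (A B : ∀ t, Matrix (Fin (m t) × Fin (m t)) (Fin (m t) × Fin (m t)) k) :
    tensorRFamily (fun t => A t * B t) = tensorRFamily A * tensorRFamily B := by
  ext p q
  simp only [tensorRFamily, Matrix.mul_apply, ← Finset.prod_mul_distrib, Fintype.prod_sum]
  exact Fintype.sum_equiv (Equiv.arrowProdEquivProdArrow _ _ _) _ _ fun f => rfl

theorem isDiag_tensorRFamily [CommRing k]
    {A : ∀ t, Matrix (Fin (m t) × Fin (m t)) (Fin (m t) × Fin (m t)) k}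
    (hA : ∀ t, (A t).IsDiag) : (tensorRFamily A).IsDiag := by
  intro p q hpq
  obtain ⟨t, ht⟩ : ∃ t, (p.1 t, p.2 t) ≠ (q.1 t, q.2 t) := by
    by_contra! h
    exact hpq (Prod.ext (funext fun t => congrArg Prod.fst (h t))
      (funext fun t => congrArg Prod.snd (h t)))
  exact Finset.prod_eq_zero (Finset.mem_univ t) (hA t ht)

theorem tensorRFamily_one [CommRing k] :
    tensorRFamily (fun t => (1 : Matrix (Fin (m t) × Fin (m t)) (Fin (m t) × Fin (m t)) k)) =
      1 := by
  ext p q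
  rcases eq_or_ne p q with rfl | hpq
  · simp [tensorRFamily]
  · rw [isDiag_tensorRFamily (fun t => isDiag_one) hpq, Matrix.one_apply_ne hpq]

theorem tensorRFamily_flipMatrix [CommRing k] :
    tensorRFamily (fun t => flipMatrix k (Fin (m t))) =
      flipMatrix k ((t : Fin n) → Fin (m t)) := by
  ext p q
  simp only [tensorRFamily, flipMatrix, Finset.prod_ite_zero, Finset.prod_const_one,
    Finset.mem_univ, true_imp_iff, funext_iff, forall_and]

theorem tensorRFamily_smul [CommRing k] (c : Fin n → k)
    (A : ∀ t, Matrix (Fin (m t) × Fin (m t)) (Fin (m t) × Fin (m t)) k) :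
    tensorRFamily (fun t => c t • A t) = (∏ t, c t) • tensorRFamily A := by
  ext p q
  simp [tensorRFamily, Finset.prod_mul_distrib]

theorem tensorRFamily_sum [CommRing k] (I : Fin n → Finset k)
    (E : ∀ t, k → Matrix (Fin (m t) × Fin (m t)) (Fin (m t) × Fin (m t)) k) :
    tensorRFamily (fun t => ∑ l ∈ I t, E t l) =
      ∑ f ∈ Fintype.piFinset I, tensorRFamily (fun t => E t (f t)) := by
  ext p q
  simp only [tensorRFamily, Matrix.sum_apply, Finset.prod_univ_sum]

end TensorRFamily

/-- An element annihilated by `∏ l ∈ s, (X - C l)` has a resolution of the identity into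
eigenprojections. -/
theorem exists_sum_eq_one_and_mul_eq_smul {k A : Type*} [Field k] [Ring A] [Algebra k A]
    (s : Finset k) (a : A) (ha : aeval a (∏ l ∈ s, (X - C l)) = 0) :
    ∃ E : k → A, ∑ l ∈ s, E l = 1 ∧ ∀ l ∈ s, a * E l = l • E l := by
  classical
  rcases s.eq_empty_or_nonempty with rfl | hs
  · exact ⟨0, by simpa using ha.symm, by simp⟩
  refine ⟨fun l => aeval a (Lagrange.basis s id l), ?_, fun l hl => ?_⟩
  · rw [← map_sum, Lagrange.sum_basis Function.injective_id.injOn hs, map_one]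
  · have h : aeval a ((X - C l) * Lagrange.basis s id l) = 0 := by
      simp only [Lagrange.basis, Lagrange.basisDivisor, id, Finset.prod_mul_distrib]
      rw [mul_left_comm, Finset.mul_prod_erase s (fun l => X - C l) hl, map_mul, ha, mul_zero]
    rw [map_mul, map_sub, aeval_X, aeval_C, sub_mul, sub_eq_zero] at h
    rw [h, Algebra.smul_def]

theorem tensorRFamily_char_poly_and_diagonalizable {k : Type*} [Field k]
    {n : ℕ} {m : Fin n → ℕ}
    (R : ∀ t, Matrix (Fin (m t) × Fin (m t)) (Fin (m t) × Fin (m t)) k)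
    (I : Fin n → Finset k)
    (hmin : ∀ t, Polynomial.aeval (flipMatrix k (Fin (m t)) * R t)
      (∏ l ∈ I t, (X - C l)) = 0) :
    Polynomial.aeval (flipMatrix k ((t : Fin n) → Fin (m t)) * tensorRFamily R)
      (∏ f ∈ Fintype.piFinset I, (X - C (∏ t, f t))) = 0 ∧
    ((∀ t, IsDiagonalizable (flipMatrix k (Fin (m t)) * R t)) →
      IsDiagonalizable (flipMatrix k ((t : Fin n) → Fin (m t)) * tensorRFamily R)) := by
  classical
  rw [← tensorRFamily_flipMatrix, ← tensorRFamily_mul]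
  refine ⟨?_, fun h => ?_⟩
  · choose E hE1 hE using fun t => exists_sum_eq_one_and_mul_eq_smul (I t) _ (hmin t)
    rw [← mul_one (aeval _ _), ← tensorRFamily_one, ← funext hE1, tensorRFamily_sum,
      Finset.mul_sum]
    refine Finset.sum_eq_zero fun f hf => ?_
    have key : tensorRFamily (fun t => flipMatrix k (Fin (m t)) * R t) *
        tensorRFamily (fun t => E t (f t)) = (∏ t, f t) • tensorRFamily (fun t => E t (f t)) := by
      rw [← tensorRFamily_mul, ← tensorRFamily_smul]
      exact congrArg tensorRFamily (funext fun t => hE t _ (Fintype.mem_piFinset.mp hf t))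
    rw [← Finset.prod_erase_mul _ _ hf, map_mul, mul_assoc, map_sub, aeval_X, aeval_C, sub_mul,
      key, Algebra.smul_def, sub_self, mul_zero]
  · choose Q hQ hD using h
    have hinv : tensorRFamily (fun t => (Q t)⁻¹) * tensorRFamily Q = 1 := by
      rw [← tensorRFamily_mul, ← tensorRFamily_one]
      exact congrArg tensorRFamily (funext fun t => nonsing_inv_mul _ (hQ t))
    refine ⟨tensorRFamily Q, isUnit_det_of_left_inverse hinv, ?_⟩
    rw [inv_eq_left_inv hinv, ← tensorRFamily_mul, ← tensorRFamily_mul]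
    exact isDiag_tensorRFamily hD
end

section
/- Let k be a field, q ∈ k a unit, and n ≥ 1 an integer. Then the type-A R-matrix R_q(n) satisfies the Hecke relation (P · R_q(n) − q·Id)(P · R_q(n) + q⁻¹·Id) = 0, where P is the flip matrix on {1,…,n}. -/
/-!
STATEMENT 8: For a unit `q` in a field `k` and `n ≥ 1`, the type-A R-matrix `R_q(n)`
satisfies the Hecke relation `(P·R_q(n) − q·Id)(P·R_q(n) + q⁻¹·Id) = 0`,
where `P` is the flip matrix on `{1,…,n}` (modelled as `Fin n`).
-/

open Matrix

/-- The type-A R-matrix `R_q(n)`, with entries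
`(R_q(n))^{ij}_{kl} = q^{δ_{ij}} δ_{ik} δ_{jl} + (q − q⁻¹) δ_{il} δ_{jk} θ(j − i)`,
where `θ(x) = 1` iff `x > 0`. Rows and columns are indexed by pairs `(i,j)`. -/
def typeAR {k : Type*} [Field k] (q : k) (n : ℕ) :
    Matrix (Fin n × Fin n) (Fin n × Fin n) k :=
  fun p r =>
    (if p.1 = p.2 then q else 1) * (if p.1 = r.1 ∧ p.2 = r.2 then 1 else 0) +
    (q - q⁻¹) * (if p.1 = r.2 ∧ p.2 = r.1 ∧ p.1 < p.2 then 1 else 0)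

theorem flipMatrix_mul_apply {k S T : Type*} [Semiring k] [Fintype S] [DecidableEq S]
    (A : Matrix (S × S) T k) (p : S × S) (r : T) :
    (flipMatrix k S * A) p r = A p.swap r := by
  have h : ∀ s : S × S, flipMatrix k S p s = if s = p.swap then 1 else 0 := by
    intro s
    simp only [flipMatrix, Prod.ext_iff, Prod.fst_swap, Prod.snd_swap]
    congr 1
    exact propext ⟨fun h => ⟨h.2.symm, h.1.symm⟩, fun h => ⟨h.2.symm, h.1.symm⟩⟩
  simp [Matrix.mul_apply, h]

theorem typeAR_mul_apply {k T : Type*} [Field k] (q : k) (n : ℕ)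
    (A : Matrix (Fin n × Fin n) T k) (p : Fin n × Fin n) (r : T) :
    (typeAR q n * A) p r =
      (if p.1 = p.2 then q else 1) * A p r +
        (if p.1 < p.2 then q - q⁻¹ else 0) * A p.swap r := by
  have h : ∀ s : Fin n × Fin n, typeAR q n p s =
      (if s = p then (if p.1 = p.2 then q else 1) else 0) +
        (if s = p.swap then (if p.1 < p.2 then q - q⁻¹ else 0) else 0) := by
    intro s
    simp only [typeAR, Prod.ext_iff, Prod.fst_swap, Prod.snd_swap]
    grind
  simp [Matrix.mul_apply, h, add_mul, Finset.sum_add_distrib]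

theorem flipMatrix_mul_typeAR_mul_apply {k T : Type*} [Field k] (q : k) (n : ℕ)
    (A : Matrix (Fin n × Fin n) T k) (p : Fin n × Fin n) (r : T) :
    (flipMatrix k (Fin n) * typeAR q n * A) p r =
      (if p.2 = p.1 then q else 1) * A p.swap r +
        (if p.2 < p.1 then q - q⁻¹ else 0) * A p r := by
  rw [Matrix.mul_assoc, flipMatrix_mul_apply, typeAR_mul_apply]
  rfl

theorem typeAR_hecke {k : Type*} [Field k] (q : k) (hq : IsUnit q) (n : ℕ) (hn : 1 ≤ n) :
    (flipMatrix k (Fin n) * typeAR q n - q • (1 : Matrix (Fin n × Fin n) (Fin n × Fin n) k)) *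
      (flipMatrix k (Fin n) * typeAR q n + q⁻¹ • (1 : Matrix (Fin n × Fin n) (Fin n × Fin n) k))
      = 0 := by
  ext p r
  rw [Matrix.sub_mul, Matrix.smul_mul, Matrix.one_mul, Matrix.sub_apply, Matrix.smul_apply,
    flipMatrix_mul_typeAR_mul_apply, ← Matrix.mul_one (flipMatrix k (Fin n) * typeAR q n)]
  simp only [Matrix.add_apply, Matrix.smul_apply, flipMatrix_mul_typeAR_mul_apply,
    smul_eq_mul, Prod.fst_swap, Prod.snd_swap, Matrix.zero_apply]
  rw [Prod.swap_swap]
  have hq0 : q ≠ 0 := hq.ne_zero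
  rcases lt_trichotomy p.1 p.2 with h | h | h
  · simp only [h, h.ne, h.ne', h.not_gt, if_true, if_false]
    field_simp
    ring
  · have hs : p.swap = p := Prod.ext h.symm h
    simp only [h, lt_irrefl, if_true, if_false]
    rw [hs]
    field_simp
    ring
  · simp only [h, h.ne, h.ne', h.not_gt, if_true, if_false]
    field_simp
    ring
end
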